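/- arXiv:1105.4562 — 2 statements merged into one kernel-verified Lean document; each statement's English description precedes it below -/
import Mathlib

section
/- There is a constant C > 0 such that for every measurable function φ : (0,∞) → ℂ, every A > 0 with |φ(t)| ≤ A for almost every t > 0, and all x, y > 0 with either 0 < y < x/2 or 0 < 2x < y, one has |K_φ^H(x,y)| ≤ C · A/max{x,y}. -/
open MeasureTheory Set

/-- The Hermite heat kernel `W_t^H(x,y)`. -/
noncomputable def WH (t x y : ℝ) : ℝ :=
  (1 / Real.sqrt Real.pi) * Real.sqrt (Real.exp (-t) / (1 - Real.exp (-2*t))) *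
    Real.exp (-(((x - Real.exp (-t) * y)^2 + (y - Real.exp (-t) * x)^2) /
      (2 * (1 - Real.exp (-2*t)))))

/-- The kernel `K_φ^H(x,y) = ∫_0^∞ φ(t) (-∂_t W_t^H(x,y)) dt`. -/
noncomputable def KH (φ : ℝ → ℂ) (x y : ℝ) : ℂ :=
  ∫ t in Set.Ioi (0:ℝ), φ t * ((-(deriv (fun s => WH s x y) t) : ℝ) : ℂ)

lemma WH_eq_sinh_cosh {t : ℝ} (ht : 0 < t) (x y : ℝ) :
    WH t x y = (1 / √Real.pi) * ((√(2 * Real.sinh t))⁻¹ *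
      Real.exp (-(((x ^ 2 + y ^ 2) * Real.cosh t - 2 * x * y) / (2 * Real.sinh t)))) := by
  have he : Real.exp (-t) < 1 := by simpa using ht
  have hp : 0 < Real.exp (-t) := Real.exp_pos _
  have h2 : Real.exp (-2 * t) = Real.exp (-t) ^ 2 := by
    rw [← Real.exp_nat_mul]
    congr 1
    push_cast
    ring
  have h1 : Real.exp t = (Real.exp (-t))⁻¹ := by rw [Real.exp_neg, inv_inv]
  have hd : 0 < 1 - Real.exp (-t) ^ 2 := by nlinarith
  unfold WH
  rw [Real.sinh_eq, Real.cosh_eq, h2, h1, ← Real.sqrt_inv, mul_assoc]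
  generalize Real.exp (-t) = e at *
  have hs : e⁻¹ - e ≠ 0 := by
    have : e⁻¹ - e = (1 - e ^ 2) / e := by field_simp
    rw [this]
    positivity
  congr 3
  · field_simp
  · congr 1
    field_simp
    ring

lemma hasDerivAt_WH {t : ℝ} (ht : 0 < t) (x y : ℝ) :
    HasDerivAt (fun s => WH s x y)
      (-((1 / √Real.pi) * ((√(2 * Real.sinh t))⁻¹ *
        Real.exp (-(((x ^ 2 + y ^ 2) * Real.cosh t - 2 * x * y) / (2 * Real.sinh t))) *
        (Real.cosh t / (2 * Real.sinh t) +
          (2 * x * y * Real.cosh t - (x ^ 2 + y ^ 2)) / (2 * Real.sinh t ^ 2))))) t := by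
  have hs : 0 < Real.sinh t := Real.sinh_pos_iff.2 ht
  have hsinh := (Real.hasDerivAt_sinh t).const_mul 2
  have hroot := (hsinh.sqrt (by positivity)).inv (by positivity)
  have hexp := (((((Real.hasDerivAt_cosh t).const_mul (x ^ 2 + y ^ 2)).sub_const
    (2 * x * y)).div hsinh (by positivity)).neg).exp
  have h := (hroot.mul hexp).const_mul (1 / √Real.pi)
  refine (h.congr_of_eventuallyEq ?_).congr_deriv ?_
  · filter_upwards [Ioi_mem_nhds ht] with s hs
    exact WH_eq_sinh_cosh hs x y
  · have hc := Real.cosh_sq t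
    have hr : √(2 * Real.sinh t) ^ 2 = 2 * Real.sinh t := Real.sq_sqrt (by positivity)
    have hr0 : 0 < √(2 * Real.sinh t) := by positivity
    simp only [Pi.neg_apply, Pi.div_apply, Pi.inv_apply]
    rw [hr, ← mul_neg]
    congr 1
    generalize Real.exp _ = E
    generalize √(2 * Real.sinh t) = r at *
    field_simp
    linear_combination E * (x ^ 2 + y ^ 2) * hc

lemma abs_deriv_WH_le {t x y : ℝ} (ht : 0 < t) (hx : 0 < x) (hy : 0 < y)
    (hxy : 5 * (x * y) ≤ 2 * (x ^ 2 + y ^ 2)) :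
    |deriv (fun s => WH s x y) t| ≤ 27000 *
      (Real.cosh t / ((x ^ 2 + y ^ 2 + Real.sinh t) * √(x ^ 2 + y ^ 2 + Real.sinh t))) := by
  have hs : 0 < Real.sinh t := Real.sinh_pos_iff.2 ht
  have hc : 1 ≤ Real.cosh t := Real.one_le_cosh t
  have hb : 0 < x * y := mul_pos hx hy
  have ha : 0 < x ^ 2 + y ^ 2 := by positivity
  have hpi : 1 / √Real.pi ≤ 1 := by
    rw [div_le_one (by positivity), Real.one_le_sqrt]
    linarith [Real.pi_gt_three]
  rw [(hasDerivAt_WH ht x y).deriv, abs_neg, abs_mul, abs_mul, abs_mul, Real.abs_exp,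
    abs_of_pos (by positivity : 0 < 1 / √Real.pi),
    abs_of_pos (by positivity : 0 < (√(2 * Real.sinh t))⁻¹)]
  have hab : 2 * x * y ≤ x ^ 2 + y ^ 2 := by nlinarith [sq_nonneg (x - y)]
  have hE : Real.exp (-(((x ^ 2 + y ^ 2) * Real.cosh t - 2 * x * y) / (2 * Real.sinh t))) ≤
      Real.exp (-((x ^ 2 + y ^ 2) / Real.sinh t / 10)) := by
    rw [Real.exp_le_exp, neg_le_neg_iff, div_div, div_le_div_iff₀ (by positivity) (by positivity)]
    nlinarith [mul_nonneg ha.le (sub_nonneg.2 hc)]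
  generalize x ^ 2 + y ^ 2 = a at *
  generalize Real.sinh t = s at *
  generalize Real.cosh t = c at *
  have hD : |c / (2 * s) + (2 * x * y * c - a) / (2 * s ^ 2)| ≤ c * ((s + 2 * a) / (2 * s ^ 2)) := by
    have hsum : c / (2 * s) + (2 * x * y * c - a) / (2 * s ^ 2) =
        (s * c + 2 * x * y * c - a) / (2 * s ^ 2) := by
      field_simp
      ring
    rw [hsum, abs_div, abs_of_pos (by positivity : 0 < 2 * s ^ 2), ← mul_div_assoc]
    gcongr
    rw [abs_le]
    constructor <;> nlinarith [mul_nonneg ha.le (sub_nonneg.2 hc), mul_pos hs (by linarith : 0 < c)]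
  have hroot : (√(2 * s))⁻¹ ≤ (√s)⁻¹ := by
    gcongr
    linarith
  have hu : 0 < a / s := by positivity
  have hcube : (1 + a / s) ^ 3 * Real.exp (-(a / s / 10)) ≤ 27000 := by
    have h1 : 1 + a / s ≤ 30 * Real.exp (a / s / 30) := by
      linarith [Real.add_one_le_exp (a / s / 30)]
    have h2 : Real.exp (a / s / 30) ^ 3 * Real.exp (-(a / s / 10)) = 1 := by
      rw [← Real.exp_nat_mul, ← Real.exp_add, ← Real.exp_zero]
      congr 1
      push_cast
      ring
    calc (1 + a / s) ^ 3 * Real.exp (-(a / s / 10))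
        ≤ (30 * Real.exp (a / s / 30)) ^ 3 * Real.exp (-(a / s / 10)) := by gcongr
      _ = 27000 * (Real.exp (a / s / 30) ^ 3 * Real.exp (-(a / s / 10))) := by ring
      _ = 27000 := by rw [h2, mul_one]
  have hsqrt : (√s)⁻¹ ≤ (1 + a / s) / √(a + s) := by
    have h1 : √(a + s) = √s * √(1 + a / s) := by
      rw [← Real.sqrt_mul hs.le]
      congr 1
      field_simp
      ring
    have h2 : √(1 + a / s) ≤ 1 + a / s := by
      rw [Real.sqrt_le_left (by positivity)]
      nlinarith
    rw [inv_eq_one_div, div_le_div_iff₀ (by positivity) (by positivity), h1]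
    nlinarith [Real.sqrt_nonneg s]
  have hfac : (s + 2 * a) / (2 * s ^ 2) ≤ (1 + a / s) ^ 2 / (a + s) := by
    have : (1 + a / s) ^ 2 / (a + s) = (s + a) / s ^ 2 := by
      field_simp
      ring
    rw [this, div_le_div_iff₀ (by positivity) (by positivity)]
    nlinarith [mul_pos hs (pow_pos hs 2)]
  calc _ ≤ 1 * ((1 + a / s) / √(a + s) * Real.exp (-(a / s / 10)) *
        (c * ((1 + a / s) ^ 2 / (a + s)))) := by
        gcongr
        · exact hroot.trans hsqrt
        · exact hD.trans (by gcongr)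
    _ = ((1 + a / s) ^ 3 * Real.exp (-(a / s / 10))) * (c / ((a + s) * √(a + s))) := by
        field_simp
    _ ≤ _ := by gcongr

lemma integral_cosh_div_add_sinh {a : ℝ} (ha : 0 < a) :
    IntegrableOn (fun t => Real.cosh t / ((a + Real.sinh t) * √(a + Real.sinh t))) (Ioi 0) ∧
    ∫ t in Ioi (0 : ℝ), Real.cosh t / ((a + Real.sinh t) * √(a + Real.sinh t)) = 2 / √a := by
  have hd : ∀ t ∈ Ici (0 : ℝ), HasDerivAt (fun t => -2 * (√(a + Real.sinh t))⁻¹)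
      (Real.cosh t / ((a + Real.sinh t) * √(a + Real.sinh t))) t := by
    intro t ht
    have hs : 0 ≤ Real.sinh t := Real.sinh_nonneg_iff.2 ht
    have hp : 0 < a + Real.sinh t := by positivity
    refine (((((Real.hasDerivAt_sinh t).const_add a).sqrt hp.ne').inv
      (by positivity)).const_mul (-2)).congr_deriv ?_
    rw [Real.sq_sqrt hp.le]
    field_simp
  have hnn : ∀ t ∈ Ioi (0 : ℝ),
      0 ≤ Real.cosh t / ((a + Real.sinh t) * √(a + Real.sinh t)) := by
    intro t ht
    have hs : 0 < Real.sinh t := Real.sinh_pos_iff.2 ht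
    have := Real.cosh_pos t
    positivity
  have hlim : Filter.Tendsto (fun t => -2 * (√(a + Real.sinh t))⁻¹) Filter.atTop (nhds 0) := by
    have hsinh : Filter.Tendsto Real.sinh Filter.atTop Filter.atTop :=
      Filter.tendsto_atTop_mono' _ (by
        filter_upwards [Filter.eventually_ge_atTop 0] with t ht
        exact Real.self_le_sinh_iff.2 ht) Filter.tendsto_id
    simpa using ((Real.tendsto_sqrt_atTop.comp
      (Filter.tendsto_atTop_add_const_left _ a hsinh)).inv_tendsto_atTop).const_mul (-2)
  refine ⟨integrableOn_Ioi_deriv_of_nonneg' hd hnn hlim, ?_⟩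
  rw [integral_Ioi_of_hasDerivAt_of_nonneg' hd hnn hlim]
  simp [div_eq_mul_inv]

theorem hermite_kernel_offdiagonal_estimate :
    ∃ C > (0:ℝ), ∀ (φ : ℝ → ℂ) (A : ℝ), Measurable φ → 0 < A →
      (∀ᵐ t ∂(volume.restrict (Set.Ioi (0:ℝ))), ‖φ t‖ ≤ A) →
      ∀ x y : ℝ, ((0 < y ∧ y < x/2) ∨ (0 < x ∧ 2*x < y)) →
        ‖KH φ x y‖ ≤ C * A / max x y := by
  refine ⟨54000, by norm_num, fun φ A _ hA hφ x y h => ?_⟩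
  have hx : 0 < x := by rcases h with h | h <;> linarith [h.1, h.2]
  have hy : 0 < y := by rcases h with h | h <;> linarith [h.1, h.2]
  have hxy : 5 * (x * y) ≤ 2 * (x ^ 2 + y ^ 2) := by
    rcases h with ⟨_, h⟩ | ⟨_, h⟩
    · nlinarith [mul_pos (by linarith : 0 < 2 * x - y) (by linarith : 0 < x - 2 * y)]
    · nlinarith [mul_pos (by linarith : 0 < y - 2 * x) (by linarith : 0 < 2 * y - x)]
  have hmax : max x y ≤ √(x ^ 2 + y ^ 2) := by
    apply max_le <;> apply Real.le_sqrt_of_sq_le <;> nlinarith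
  obtain ⟨hint, hval⟩ := integral_cosh_div_add_sinh (by positivity : 0 < x ^ 2 + y ^ 2)
  have hM : 0 < max x y := lt_max_of_lt_left hx
  calc ‖KH φ x y‖ ≤ ∫ t in Ioi (0 : ℝ), A * (27000 * (Real.cosh t /
        ((x ^ 2 + y ^ 2 + Real.sinh t) * √(x ^ 2 + y ^ 2 + Real.sinh t)))) := by
        refine norm_integral_le_of_norm_le ((hint.const_mul 27000).const_mul A) ?_
        filter_upwards [hφ, ae_restrict_mem measurableSet_Ioi] with t hφt ht
        rw [norm_mul, Complex.norm_real, norm_neg, Real.norm_eq_abs]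
        exact mul_le_mul hφt (abs_deriv_WH_le ht hx hy hxy) (abs_nonneg _) hA.le
    _ = 54000 * A / √(x ^ 2 + y ^ 2) := by
        rw [integral_const_mul, integral_const_mul, hval]
        ring
    _ ≤ 54000 * A / max x y := by gcongr
end

section
/- Let α > -1/2. There is a constant C > 0 (depending only on α) such that for all x, y with 0 < y < x/2, ∫_{R(x,y)} e^{-3t/2} · (1-e^{-2t})^{-5/2} · exp(-((x - e^{-t}y)² + (y - e^{-t}x)²)/(2(1-e^{-2t}))) dt ≤ C · y^{α+1/2} / x^{α+7/2}. -/
open MeasureTheory Set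

/-- The region `R(x,y) = { t > 0 : e^{-t}xy/(1-e^{-2t}) ≥ 1 }`. -/
def Rset (x y : ℝ) : Set ℝ :=
  {t : ℝ | 0 < t ∧ 1 ≤ Real.exp (-t) * x * y / (1 - Real.exp (-2*t))}

theorem one_sub_exp_neg_two_mul_pos {t : ℝ} (ht : 0 < t) : 0 < 1 - Real.exp (-2*t) := by
  rw [sub_pos, Real.exp_lt_one_iff]
  linarith

theorem one_sub_exp_le_of_mem_Rset {x y t : ℝ} (ht : t ∈ Rset x y) :
    1 - Real.exp (-2*t) ≤ Real.exp (-t) * x * y := by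
  obtain ⟨h0, h1⟩ := ht
  rwa [one_le_div (one_sub_exp_neg_two_mul_pos h0)] at h1

theorem two_mul_le_of_mem_Rset {x y t : ℝ} (ht : t ∈ Rset x y) : 2 * t ≤ x * y := by
  have h := one_sub_exp_le_of_mem_Rset ht
  have hsinh := Real.self_le_sinh_iff.2 ht.1.le
  rw [Real.sinh_eq] at hsinh
  have e1 : Real.exp t * Real.exp (-t) = 1 := by rw [← Real.exp_add]; simp
  have e2 : Real.exp (-2*t) = Real.exp (-t) * Real.exp (-t) := by
    rw [← Real.exp_add]; ring_nf
  have h3 := mul_le_mul_of_nonneg_left h (Real.exp_pos t).le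
  have h4 : Real.exp t * (1 - Real.exp (-2*t)) = Real.exp t - Real.exp (-t) := by
    rw [e2]; linear_combination (-Real.exp (-t)) * e1
  have h5 : Real.exp t * (Real.exp (-t) * x * y) = x * y := by
    linear_combination (x * y) * e1
  linarith

theorem Rset_subset_Icc (x y : ℝ) : Rset x y ⊆ Icc 0 (x * y / 2) := fun t ht =>
  ⟨ht.1.le, by linarith [two_mul_le_of_mem_Rset ht]⟩

theorem volume_real_Rset_le {x y : ℝ} (hxy : 0 ≤ x * y) :
    volume.real (Rset x y) ≤ x * y / 2 := by
  refine (measureReal_mono (Rset_subset_Icc x y) measure_Icc_lt_top.ne).trans ?_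
  rw [Real.volume_real_Icc_of_le (by positivity), sub_zero]

theorem exp_neg_le_rpow_neg {p u : ℝ} (hp : 0 < p) (hu : 0 < u) :
    Real.exp (-u) ≤ p ^ p * u ^ (-p) := by
  have h : u / p ≤ Real.exp (u / p) := by linarith [Real.add_one_le_exp (u / p)]
  have h2 := Real.rpow_le_rpow (by positivity) h hp.le
  rw [← Real.exp_mul, div_mul_cancel₀ _ hp.ne', Real.div_rpow hu.le hp.le,
    div_le_iff₀ (by positivity)] at h2
  rw [Real.exp_neg, Real.rpow_neg hu.le, ← div_eq_mul_inv,
    inv_le_comm₀ (Real.exp_pos u) (by positivity), inv_div]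
  exact (div_le_iff₀ (by positivity)).2 h2

theorem integrand_le_of_mem_Rset {a x y t : ℝ} (ha : 0 ≤ a) (hy : 0 < y) (hyx : y < x/2)
    (ht : t ∈ Rset x y) :
    Real.exp (-3*t/2) * (1 - Real.exp (-2*t)) ^ (-(5:ℝ)/2) *
          Real.exp (-(((x - Real.exp (-t) * y)^2 + (y - Real.exp (-t) * x)^2) /
            (2 * (1 - Real.exp (-2*t))))) ≤
      (a + 5/2) ^ (a + 5/2) * 8 ^ (a + 5/2) * y ^ a * x ^ (-a - 5) := by
  have ht0 := ht.1
  have hs := one_sub_exp_neg_two_mul_pos ht0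
  have hsle := one_sub_exp_le_of_mem_Rset ht
  have hx : 0 < x := by linarith
  have hr0 := Real.exp_pos (-t)
  have hr1 : Real.exp (-t) ≤ 1 := Real.exp_le_one_iff.2 (by linarith)
  set r := Real.exp (-t)
  set s := 1 - Real.exp (-2*t)
  have hsxy : s ≤ x * y := by
    have := mul_le_mul_of_nonneg_right hr1 (mul_pos hx hy).le
    linarith
  have hexp : Real.exp (-(((x - r * y)^2 + (y - r * x)^2) / (2 * s))) ≤
      Real.exp (-(x^2 / (8 * s))) := by
    rw [Real.exp_le_exp, neg_le_neg_iff, div_le_div_iff₀ (by positivity) (by positivity)]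
    have h1 : r * y ≤ y := by nlinarith
    have h2 : (x/2)^2 ≤ (x - r * y)^2 := pow_le_pow_left₀ (by positivity) (by linarith) 2
    nlinarith [sq_nonneg (y - r * x)]
  have h1 : Real.exp (-3*t/2) ≤ 1 := Real.exp_le_one_iff.2 (by linarith)
  have hp : 0 < a + 5/2 := by linarith
  have hrpow : (x^2 / (8 * s)) ^ (-(a + 5/2)) =
      8 ^ (a + 5/2) * s ^ (a + 5/2) * x ^ (-2*a - 5) := by
    rw [Real.div_rpow (by positivity) (by positivity), Real.rpow_neg (by positivity : 0 ≤ 8 * s),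
      div_inv_eq_mul, Real.mul_rpow (by positivity) hs.le, ← Real.rpow_natCast,
      ← Real.rpow_mul hx.le, mul_comm]
    congr 2
    push_cast
    ring
  calc _ ≤ 1 * s ^ (-(5:ℝ)/2) * ((a + 5/2) ^ (a + 5/2) * (x^2 / (8 * s)) ^ (-(a + 5/2))) := by
        gcongr
        exact hexp.trans (exp_neg_le_rpow_neg hp (by positivity))
    _ = (a + 5/2) ^ (a + 5/2) * 8 ^ (a + 5/2) * s ^ a * x ^ (-2*a - 5) := by
        have : s ^ a = s ^ (-(5:ℝ)/2) * s ^ (a + 5/2) := by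
          rw [← Real.rpow_add hs]; ring_nf
        rw [hrpow, this]; ring
    _ ≤ (a + 5/2) ^ (a + 5/2) * 8 ^ (a + 5/2) * (x * y) ^ a * x ^ (-2*a - 5) := by
        gcongr
    _ = _ := by
        have : x ^ (-a - 5) = x ^ a * x ^ (-2*a - 5) := by
          rw [← Real.rpow_add hx]; ring_nf
        rw [Real.mul_rpow hx.le hy.le, this]; ring

theorem laguerre_global_region_estimate (α : ℝ) (hα : -1/2 < α) :
    ∃ C > (0:ℝ), ∀ x y : ℝ, 0 < y → y < x/2 →
      (∫ t in Rset x y,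
        Real.exp (-3*t/2) * (1 - Real.exp (-2*t)) ^ (-(5:ℝ)/2) *
          Real.exp (-(((x - Real.exp (-t) * y)^2 + (y - Real.exp (-t) * x)^2) /
            (2 * (1 - Real.exp (-2*t)))))) ≤
        C * y ^ (α + 1/2) / x ^ (α + 7/2) := by
  have ha : 0 < α + 1/2 := by linarith
  set a := α + 1/2
  have haα : α + 7/2 = a + 3 := by simp only [a]; ring
  set K : ℝ := (a + 5/2) ^ (a + 5/2) * 8 ^ (a + 5/2)
  have hK : 0 < K := by positivity
  refine ⟨K, hK, fun x y hy hyx => ?_⟩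
  have hx : 0 < x := by linarith
  have hvol := volume_real_Rset_le (mul_pos hx hy).le
  have hfin : volume (Rset x y) < ⊤ :=
    (measure_mono (Rset_subset_Icc x y)).trans_lt measure_Icc_lt_top
  refine (Real.le_norm_self _).trans <|
    (norm_setIntegral_le_of_norm_le_const (C := K * y ^ a * x ^ (-a - 5)) hfin
      fun t ht => ?_).trans ?_
  · have := one_sub_exp_neg_two_mul_pos ht.1
    rw [Real.norm_of_nonneg (by positivity)]
    exact integrand_le_of_mem_Rset ha.le hy hyx ht
  · have hvol' : volume.real (Rset x y) ≤ x ^ (2:ℝ) := by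
      rw [Real.rpow_two]
      nlinarith
    calc _ ≤ K * y ^ a * x ^ (-a - 5) * x ^ (2:ℝ) := by gcongr
      _ = K * y ^ a * x ^ (-(a + 3)) := by
        rw [mul_assoc, ← Real.rpow_add hx]; ring_nf
      _ = _ := by rw [haα, Real.rpow_neg hx.le, div_eq_mul_inv]
end
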